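/- arXiv:1705.07439 — 5 statements merged into one kernel-verified Lean document; each statement's English description precedes it below -/
import Mathlib

section
/- Let A ∈ ℝ^{m×n} with m ≥ n have full column rank, let W ∈ ℝ^{m×m} be symmetric positive definite, let b ∈ ℝ^m, and let L ∈ ℝ^{n×k} with k ≤ n. Define the weighted generalized inverse A† := (AᵀWA)⁻¹AᵀW, the weighted least squares solution x := A†b, and the weighted residual d := W(b − Ax). Then the map g : ℝ^{m×n} × ℝ^m → ℝ^k given by g(Â, b̂) = Lᵀ(ÂᵀWÂ)⁻¹ÂᵀWb̂ (defined on the open set of full-column-rank Â) is Fréchet differentiable at (A, b), with derivative the linear map J(B, c) = Lᵀ((AᵀWA)⁻¹Bᵀd − A†Bx) + LᵀA†c for B ∈ ℝ^{m×n}, c ∈ ℝ^m. -/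
open Matrix

attribute [local instance] Matrix.normedAddCommGroup Matrix.normedSpace

/-- `f` is Fréchet differentiable at `x`, with derivative given pointwise by `φ`. -/
def HasFDerivFormulaAt {E F : Type*} [NormedAddCommGroup E] [NormedSpace ℝ E]
    [NormedAddCommGroup F] [NormedSpace ℝ F] (f φ : E → F) (x : E) : Prop :=
  ∃ D : E →L[ℝ] F, (∀ v, D v = φ v) ∧ HasFDerivAt f D x

namespace HasFDerivFormulaAt

variable {E F G H l m n : Type*} [NormedAddCommGroup E] [NormedSpace ℝ E]
  [NormedAddCommGroup F] [NormedSpace ℝ F] [NormedAddCommGroup G] [NormedSpace ℝ G]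
  [NormedAddCommGroup H] [NormedSpace ℝ H] [Fintype l] [Fintype m] [Fintype n]

theorem const (c : F) (x : E) : HasFDerivFormulaAt (fun _ => c) (fun _ => 0) x :=
  ⟨0, fun _ => rfl, hasFDerivAt_const c x⟩

theorem comp {g γ : F → G} {f φ : E → F} {x : E} (hg : HasFDerivFormulaAt g γ (f x))
    (hf : HasFDerivFormulaAt f φ x) :
    HasFDerivFormulaAt (fun y => g (f y)) (fun v => γ (φ v)) x := by
  obtain ⟨D, e, h⟩ := hg
  obtain ⟨D', e', h'⟩ := hf
  exact ⟨D.comp D', fun v => by rw [ContinuousLinearMap.comp_apply, e, e'], h.comp x h'⟩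

/-- Leibniz rule for a bilinear map between finite-dimensional spaces. -/
theorem bilinear [FiniteDimensional ℝ F] [FiniteDimensional ℝ G]
    (T : F →ₗ[ℝ] G →ₗ[ℝ] H) {f φ : E → F} {g γ : E → G} {x : E}
    (hf : HasFDerivFormulaAt f φ x) (hg : HasFDerivFormulaAt g γ x) :
    HasFDerivFormulaAt (fun y => T (f y) (g y)) (fun v => T (f x) (γ v) + T (φ v) (g x)) x := by
  obtain ⟨D, e, h⟩ := hf
  obtain ⟨D', e', h'⟩ := hg
  let S : F →L[ℝ] G →L[ℝ] H :=
    LinearMap.toContinuousLinearMap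
      ((LinearMap.toContinuousLinearMap (𝕜 := ℝ) (E := G) (F' := H)).toLinearMap ∘ₗ T)
  refine ⟨_, fun v => ?_, S.hasFDerivAt_of_bilinear h h'⟩
  beta_reduce
  rw [← e, ← e']
  rfl

theorem matrix_mul {f φ : E → Matrix l m ℝ} {g γ : E → Matrix m n ℝ} {x : E}
    (hf : HasFDerivFormulaAt f φ x) (hg : HasFDerivFormulaAt g γ x) :
    HasFDerivFormulaAt (fun y => f y * g y) (fun v => f x * γ v + φ v * g x) x :=
  bilinear
    (LinearMap.mk₂ ℝ (fun (P : Matrix l m ℝ) (Q : Matrix m n ℝ) => P * Q)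
      Matrix.add_mul (fun c P Q => Matrix.smul_mul c P Q) Matrix.mul_add
      (fun c P Q => Matrix.mul_smul P c Q)) hf hg

theorem matrix_mulVec {f φ : E → Matrix l m ℝ} {g γ : E → m → ℝ} {x : E}
    (hf : HasFDerivFormulaAt f φ x) (hg : HasFDerivFormulaAt g γ x) :
    HasFDerivFormulaAt (fun y => f y *ᵥ g y) (fun v => f x *ᵥ γ v + φ v *ᵥ g x) x :=
  bilinear (Matrix.mulVecBilin ℝ ℝ) hf hg

theorem matrix_transpose (A : Matrix m n ℝ) :
    HasFDerivFormulaAt (fun B : Matrix m n ℝ => Bᵀ) (fun B => Bᵀ) A :=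
  let τ : Matrix m n ℝ →L[ℝ] Matrix n m ℝ :=
    LinearMap.toContinuousLinearMap (Matrix.transposeLinearEquiv m n ℝ ℝ).toLinearMap
  ⟨τ, fun _ => rfl, τ.hasFDerivAt⟩

end HasFDerivFormulaAt

section

attribute [local instance] Matrix.linftyOpNormedRing Matrix.linftyOpNormedAlgebra

theorem Matrix.exists_hasFDerivAt_inv_linftyOp {n : Type*} [Fintype n] [DecidableEq n]
    (M : Matrix n n ℝ) (hM : IsUnit M) :
    ∃ D : Matrix n n ℝ →L[ℝ] Matrix n n ℝ, (∀ V, D V = -(M⁻¹ * V * M⁻¹)) ∧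
      HasFDerivAt (fun N : Matrix n n ℝ => N⁻¹) D M := by
  obtain ⟨u, rfl⟩ := hM
  have : CompleteSpace (Matrix n n ℝ) := inferInstanceAs (CompleteSpace (n → n → ℝ))
  have : HasSummableGeomSeries (Matrix n n ℝ) :=
    @instHasSummableGeomSeriesOfCompleteSpace _ Matrix.linftyOpNormedRing this
  have h := hasFDerivAt_ringInverse (𝕜 := ℝ) u
  have e : (Ring.inverse : Matrix n n ℝ → Matrix n n ℝ) = fun N => N⁻¹ :=
    funext fun N => (Matrix.nonsing_inv_eq_ringInverse N).symm
  rw [e] at h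
  refine ⟨_, fun V => ?_, h⟩
  rw [← Matrix.coe_units_inv]
  rfl

end

theorem HasFDerivFormulaAt.matrix_inv {n : Type*} [Fintype n] [DecidableEq n]
    {M : Matrix n n ℝ} (hM : IsUnit M) :
    HasFDerivFormulaAt (fun N : Matrix n n ℝ => N⁻¹) (fun V => -(M⁻¹ * V * M⁻¹)) M :=
  Matrix.exists_hasFDerivAt_inv_linftyOp M hM

theorem Matrix.PosDef.isUnit_transpose_mul_mul {m n : ℕ} {A : Matrix (Fin m) (Fin n) ℝ}
    {W : Matrix (Fin m) (Fin m) ℝ} (hW : W.PosDef) (hA : A.rank = n) :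
    IsUnit (Aᵀ * W * A) := by
  have hinj : Function.Injective A.mulVec := by
    rw [Matrix.mulVec_injective_iff, linearIndependent_iff_card_eq_finrank_span, Set.finrank,
      ← Matrix.rank_eq_finrank_span_cols, hA, Fintype.card_fin]
  have h := hW.conjTranspose_mul_mul_same hinj
  rw [Matrix.conjTranspose_eq_transpose_of_trivial] at h
  exact h.isUnit

/-- the map `g(Â, b̂) = Lᵀ(ÂᵀWÂ)⁻¹ÂᵀWb̂` is Fréchet differentiable at
`(A, b)` with derivative `J(B, c) = Lᵀ((AᵀWA)⁻¹Bᵀd − A†Bx) + LᵀA†c`. -/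
theorem wls_frechet_derivative
    {m n k : ℕ} (hmn : n ≤ m) (hk : k ≤ n)
    (A : Matrix (Fin m) (Fin n) ℝ) (hA : A.rank = n)
    (W : Matrix (Fin m) (Fin m) ℝ) (hWsym : W.IsSymm) (hW : W.PosDef)
    (b : Fin m → ℝ) (L : Matrix (Fin n) (Fin k) ℝ) :
    let Adag := (Aᵀ * W * A)⁻¹ * Aᵀ * W
    let x := Adag *ᵥ b
    let d := W *ᵥ (b - A *ᵥ x)
    ∃ J : (Matrix (Fin m) (Fin n) ℝ × (Fin m → ℝ)) →L[ℝ] (Fin k → ℝ),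
      (∀ (B : Matrix (Fin m) (Fin n) ℝ) (c : Fin m → ℝ),
        J (B, c) =
          Lᵀ *ᵥ ((Aᵀ * W * A)⁻¹ *ᵥ (Bᵀ *ᵥ d) - Adag *ᵥ (B *ᵥ x)) +
            (Lᵀ * Adag) *ᵥ c) ∧
      HasFDerivAt
        (fun p : Matrix (Fin m) (Fin n) ℝ × (Fin m → ℝ) =>
          (Lᵀ * ((p.1ᵀ * W * p.1)⁻¹ * p.1ᵀ * W)) *ᵥ p.2)
        J (A, b) := by
  intro Adag x d
  have hfst : HasFDerivFormulaAt (fun p : Matrix (Fin m) (Fin n) ℝ × (Fin m → ℝ) => p.1)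
      (fun v => v.1) (A, b) := ⟨ContinuousLinearMap.fst ℝ _ _, fun _ => rfl, hasFDerivAt_fst⟩
  have hsnd : HasFDerivFormulaAt (fun p : Matrix (Fin m) (Fin n) ℝ × (Fin m → ℝ) => p.2)
      (fun v => v.2) (A, b) := ⟨ContinuousLinearMap.snd ℝ _ _, fun _ => rfl, hasFDerivAt_snd⟩
  have htr := (HasFDerivFormulaAt.matrix_transpose A).comp hfst
  have hWc := HasFDerivFormulaAt.const W (A, b)
  have hLc := HasFDerivFormulaAt.const Lᵀ (A, b)
  have hinv := (HasFDerivFormulaAt.matrix_inv (hW.isUnit_transpose_mul_mul hA)).comp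
    (f := fun p : Matrix (Fin m) (Fin n) ℝ × (Fin m → ℝ) => p.1ᵀ * W * p.1)
    (x := (A, b)) ((htr.matrix_mul hWc).matrix_mul hfst)
  obtain ⟨J, e, h⟩ := (hLc.matrix_mul ((hinv.matrix_mul htr).matrix_mul hWc)).matrix_mulVec hsnd
  refine ⟨J, fun B c => (e (B, c)).trans ?_, h⟩
  simp only [d, x, Adag, Matrix.mul_zero, Matrix.zero_mul, zero_add, add_zero]
  simp only [Matrix.mulVec_mulVec, Matrix.mulVec_sub, Matrix.add_mulVec,
    Matrix.neg_mulVec, Matrix.mul_add, Matrix.add_mul, Matrix.mul_neg,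
    Matrix.neg_mul, Matrix.mul_assoc]
  abel
end

section
/- Let A ∈ ℝ^{m×n} with m ≥ n have full column rank, let W ∈ ℝ^{m×m} be symmetric positive definite, and let b ∈ ℝ^m. Define A† := (AᵀWA)⁻¹AᵀW, x := A†b, d := W(b − Ax), let L ∈ ℝ^{n×k}, and set V := (AᵀWA)⁻¹ ⊗ dᵀ − xᵀ ⊗ A† ∈ ℝ^{n×mn}. Then the mixed condition number K_∞ := ‖ |LᵀV| vec(|A|) + |LᵀA†| |b| ‖_∞ satisfies the upper bound K_∞ ≤ ‖Lᵀ(AᵀWA)⁻¹ D_{|A|ᵀ|d|}‖_∞ + ‖LᵀA† D_{|A||x|}‖_∞ + ‖LᵀA† D_{|b|}‖_∞, where each term on the right is a maximum absolute row-sum matrix norm. -/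
open Matrix

/-- The maximum absolute row-sum norm of a real matrix. -/
noncomputable def rowSumNorm {p q : Type*} [Fintype q] (M : Matrix p q ℝ) : ℝ :=
  ⨆ i, ∑ j, |M i j|

/-- The vector ∞-norm. -/
noncomputable def infNormV {p : Type*} (v : p → ℝ) : ℝ :=
  ⨆ i, |v i|

theorem rowSumNorm_nonneg {p q : Type*} [Fintype q] (M : Matrix p q ℝ) : 0 ≤ rowSumNorm M :=
  Real.iSup_nonneg fun _ => Finset.sum_nonneg fun _ _ => abs_nonneg _

theorem row_sum_le_rowSumNorm {p q : Type*} [Finite p] [Fintype q] (M : Matrix p q ℝ) (i : p) :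
    ∑ j, |M i j| ≤ rowSumNorm M :=
  le_ciSup (f := fun i => ∑ j, |M i j|) (Set.finite_range _).bddAbove i

theorem map_abs_mulVec_le_rowSumNorm_mul_diagonal {p q : Type*} [Finite p] [Fintype q]
    [DecidableEq q] (M : Matrix p q ℝ) (v : q → ℝ) (i : p) :
    ((M.map abs) *ᵥ v) i ≤ rowSumNorm (M * Matrix.diagonal v) := by
  simp only [Matrix.mulVec, dotProduct, Matrix.map_apply]
  refine le_trans (Finset.sum_le_sum fun j _ => ?_) (row_sum_le_rowSumNorm _ i)
  rw [Matrix.mul_diagonal, abs_mul]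
  exact mul_le_mul_of_nonneg_left (le_abs_self _) (abs_nonneg _)

theorem map_abs_mulVec_nonneg {p q : Type*} [Fintype q] (M : Matrix p q ℝ) {v : q → ℝ}
    (hv : ∀ j, 0 ≤ v j) (i : p) : 0 ≤ ((M.map abs) *ᵥ v) i :=
  Finset.sum_nonneg fun j _ => mul_nonneg (abs_nonneg (M i j)) (hv j)

theorem sum_abs_sub_mul_abs_le {p q : Type*} [Fintype p] [Fintype q]
    (A : Matrix q p ℝ) (u x : p → ℝ) (w d : q → ℝ) :
    ∑ ji : p × q, |u ji.1 * d ji.2 - x ji.1 * w ji.2| * |A ji.2 ji.1| ≤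
      ∑ j, |u j| * ((Aᵀ.map abs) *ᵥ fun l => |d l|) j +
        ∑ l, |w l| * ((A.map abs) *ᵥ fun j => |x j|) l := by
  simp only [Matrix.mulVec, dotProduct, Matrix.map_apply, Matrix.transpose_apply, Finset.mul_sum]
  rw [Finset.sum_comm (f := fun l j => |w l| * (|A l j| * |x j|)), Fintype.sum_prod_type,
    ← Finset.sum_add_distrib]
  refine Finset.sum_le_sum fun j _ => ?_
  rw [← Finset.sum_add_distrib]
  refine Finset.sum_le_sum fun l _ => ?_
  calc |u j * d l - x j * w l| * |A l j|
      ≤ (|u j * d l| + |x j * w l|) * |A l j| :=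
        mul_le_mul_of_nonneg_right (abs_sub _ _) (abs_nonneg _)
    _ = |u j| * (|A l j| * |d l|) + |w l| * (|A l j| * |x j|) := by
        rw [abs_mul, abs_mul]; ring

/-- the upper bound for the mixed condition number:
`K_∞ ≤ ‖Lᵀ(AᵀWA)⁻¹ D_{|A|ᵀ|d|}‖_∞ + ‖LᵀA† D_{|A||x|}‖_∞ + ‖LᵀA† D_{|b|}‖_∞`. -/
theorem wls_mixed_condition_number_upper_bound
    {m n k : ℕ} (hmn : n ≤ m)
    (A : Matrix (Fin m) (Fin n) ℝ) (hA : A.rank = n)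
    (W : Matrix (Fin m) (Fin m) ℝ) (hWsym : W.IsSymm) (hW : W.PosDef)
    (b : Fin m → ℝ) (L : Matrix (Fin n) (Fin k) ℝ) :
    let C := (Aᵀ * W * A)⁻¹
    let Adag := C * Aᵀ * W
    let x := Adag *ᵥ b
    let d := W *ᵥ (b - A *ᵥ x)
    let V : Matrix (Fin n) (Fin n × Fin m) ℝ :=
      Matrix.of fun r ji => C r ji.1 * d ji.2 - x ji.1 * Adag r ji.2
    infNormV (((Lᵀ * V).map abs) *ᵥ (fun ji : Fin n × Fin m => |A ji.2 ji.1|) +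
        ((Lᵀ * Adag).map abs) *ᵥ (fun i => |b i|)) ≤
      rowSumNorm (Lᵀ * C * Matrix.diagonal ((Aᵀ.map abs) *ᵥ (fun i => |d i|))) +
      rowSumNorm (Lᵀ * Adag * Matrix.diagonal ((A.map abs) *ᵥ (fun j => |x j|))) +
      rowSumNorm (Lᵀ * Adag * Matrix.diagonal (fun i => |b i|)) := by
  intro C Adag x d V
  have hV : ∀ i ji, (Lᵀ * V) i ji = (Lᵀ * C) i ji.1 * d ji.2 - x ji.1 * (Lᵀ * Adag) i ji.2 := by
    intro i ji
    simp only [Matrix.mul_apply, V, Matrix.of_apply, Finset.sum_mul, Finset.mul_sum,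
      ← Finset.sum_sub_distrib]
    exact Finset.sum_congr rfl fun r _ => by ring
  refine Real.iSup_le (fun i => ?_) (add_nonneg (add_nonneg (rowSumNorm_nonneg _)
    (rowSumNorm_nonneg _)) (rowSumNorm_nonneg _))
  rw [Pi.add_apply, abs_of_nonneg (add_nonneg
    (map_abs_mulVec_nonneg _ (fun _ => abs_nonneg _) i)
    (map_abs_mulVec_nonneg _ (fun _ => abs_nonneg _) i))]
  refine add_le_add ?_ (map_abs_mulVec_le_rowSumNorm_mul_diagonal _ _ i)
  rw [Matrix.mulVec, dotProduct]
  simp only [Matrix.map_apply, hV]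
  exact (sum_abs_sub_mul_abs_le A ((Lᵀ * C) i) x ((Lᵀ * Adag) i) d).trans
    (add_le_add (map_abs_mulVec_le_rowSumNorm_mul_diagonal (Lᵀ * C) _ i)
      (map_abs_mulVec_le_rowSumNorm_mul_diagonal (Lᵀ * Adag) _ i))
end

section
/- Let G ∈ ℝ^{N×N} be invertible, ΔG ∈ ℝ^{N×N}, f, Δf ∈ ℝ^N, and let z solve Gz = f. Suppose the spectral radius of the nonnegative matrix |G⁻¹||ΔG| is strictly less than 1. Then G + ΔG is invertible, I − |G⁻¹||ΔG| is invertible with entrywise nonnegative inverse, and the solution z + Δz of (G + ΔG)(z + Δz) = f + Δf satisfies the componentwise bound |Δz| ≤ (I − |G⁻¹||ΔG|)⁻¹ |G⁻¹| (|Δf| + |ΔG||z|) (entrywise inequality of vectors). -/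
open Matrix

open Filter Topology in
theorem tendsto_pow_nhds_zero_of_spectralRadius_lt_one {A : Type*} [NormedRing A]
    [NormedAlgebra ℂ A] [CompleteSpace A] {a : A} (ha : spectralRadius ℂ a < 1) :
    Tendsto (fun n : ℕ => a ^ n) atTop (𝓝 0) := by
  obtain ⟨r, har, hr⟩ := exists_between ha
  have hlt := (spectrum.pow_nnnorm_pow_one_div_tendsto_nhds_spectralRadius a).eventually_lt_const har
  have hle : ∀ᶠ n : ℕ in atTop, (‖a ^ n‖₊ : ENNReal) ≤ r ^ n := by
    filter_upwards [hlt, eventually_gt_atTop 0] with n hn hpos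
    have h := pow_le_pow_left₀ zero_le hn.le n
    rwa [← ENNReal.rpow_natCast, ← ENNReal.rpow_mul, one_div,
      inv_mul_cancel₀ (Nat.cast_ne_zero.mpr hpos.ne'), ENNReal.rpow_one] at h
  have hzero : Tendsto (fun n : ℕ => (‖a ^ n‖₊ : ENNReal)) atTop (𝓝 0) :=
    tendsto_of_tendsto_of_tendsto_of_le_of_le' tendsto_const_nhds
      (ENNReal.tendsto_pow_atTop_nhds_zero_of_lt_one hr) (.of_forall fun _ => zero_le) hle
  rw [tendsto_zero_iff_norm_tendsto_zero]
  exact NNReal.tendsto_coe.mpr (ENNReal.tendsto_coe.mp hzero)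

namespace Matrix

section

variable {n : Type*} [Fintype n]

theorem mulVec_le_mulVec_of_nonneg {M : Matrix n n ℝ} (hM : ∀ i j, 0 ≤ M i j) {x y : n → ℝ}
    (hxy : x ≤ y) : M *ᵥ x ≤ M *ᵥ y := fun i =>
  Finset.sum_le_sum fun j _ => mul_le_mul_of_nonneg_left (hxy j) (hM i j)

theorem abs_mulVec_le (M : Matrix n n ℝ) (x : n → ℝ) : |M *ᵥ x| ≤ M.map abs *ᵥ |x| := fun _ =>
  (Finset.abs_sum_le_sum_abs _ _).trans_eq (Finset.sum_congr rfl fun _ _ => abs_mul _ _)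

variable [DecidableEq n]

open Filter Topology in
theorem tendsto_pow_of_spectralRadius_map_ofReal_lt_one {M : Matrix n n ℝ}
    (hρ : spectralRadius ℂ (M.map Complex.ofReal) < 1) :
    Tendsto (fun k : ℕ => M ^ k) atTop (𝓝 0) := by
  let _ : NormedRing (Matrix n n ℂ) := Matrix.linftyOpNormedRing
  let _ : NormedAlgebra ℂ (Matrix n n ℂ) := Matrix.linftyOpNormedAlgebra
  have h : Tendsto (fun k : ℕ => M.map Complex.ofReal ^ k) atTop (𝓝 0) :=
    tendsto_pow_nhds_zero_of_spectralRadius_lt_one hρ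
  have hre : Continuous fun A : Matrix n n ℂ => A.map Complex.re :=
    continuous_id.matrix_map Complex.continuous_re
  convert (hre.tendsto 0).comp h using 2 with k
  · have hpow : (M ^ k).map Complex.ofReal = M.map Complex.ofReal ^ k :=
      map_pow Complex.ofRealHom.mapMatrix M k
    ext i j
    simp [← hpow]
  · ext i j
    simp

/-- A subinvariant vector of a nonnegative matrix of spectral radius less than one is
nonpositive. -/
theorem nonpos_of_le_mulVec {M : Matrix n n ℝ} (hM : ∀ i j, 0 ≤ M i j)
    (hρ : spectralRadius ℂ (M.map Complex.ofReal) < 1) {x : n → ℝ} (hx : x ≤ M *ᵥ x) :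
    x ≤ 0 := by
  have hpow : ∀ k : ℕ, x ≤ M ^ k *ᵥ x := by
    intro k
    induction k with
    | zero => simp
    | succ k ih =>
      rw [pow_succ', ← mulVec_mulVec]
      exact hx.trans (mulVec_le_mulVec_of_nonneg hM ih)
  have hcont : Continuous fun A : Matrix n n ℝ => A *ᵥ x :=
    continuous_id.matrix_mulVec continuous_const
  have hlim := (hcont.tendsto 0).comp (tendsto_pow_of_spectralRadius_map_ofReal_lt_one hρ)
  rw [zero_mulVec] at hlim
  exact ge_of_tendsto' hlim hpow

theorem isUnit_of_mulVec_eq_zero {M : Matrix n n ℝ} (h : ∀ x, M *ᵥ x = 0 → x = 0) :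
    IsUnit M :=
  mulVec_injective_iff_isUnit.mp <|
    (injective_iff_map_eq_zero M.mulVecLin).mpr h

variable {M : Matrix n n ℝ}

theorem isUnit_one_sub_of_spectralRadius_lt_one (hM : ∀ i j, 0 ≤ M i j)
    (hρ : spectralRadius ℂ (M.map Complex.ofReal) < 1) : IsUnit (1 - M) := by
  refine isUnit_of_mulVec_eq_zero fun x hx => ?_
  rw [sub_mulVec, one_mulVec, sub_eq_zero] at hx
  refine le_antisymm (nonpos_of_le_mulVec hM hρ hx.le) ?_
  rw [← neg_nonpos]
  exact nonpos_of_le_mulVec hM hρ (by rw [mulVec_neg, ← hx])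

theorem le_inv_one_sub_mulVec (hM : ∀ i j, 0 ≤ M i j)
    (hρ : spectralRadius ℂ (M.map Complex.ofReal) < 1) {x b : n → ℝ} (hx : x ≤ M *ᵥ x + b) :
    x ≤ (1 - M)⁻¹ *ᵥ b := by
  have hdet := (isUnit_iff_isUnit_det _).mp (isUnit_one_sub_of_spectralRadius_lt_one hM hρ)
  have hb : (1 - M) *ᵥ ((1 - M)⁻¹ *ᵥ b) = b := by
    rw [mulVec_mulVec, mul_nonsing_inv _ hdet, one_mulVec]
  rw [sub_mulVec, one_mulVec, sub_eq_iff_eq_add'] at hb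
  rw [← sub_nonpos]
  refine nonpos_of_le_mulVec hM hρ ?_
  rw [mulVec_sub]
  calc x - (1 - M)⁻¹ *ᵥ b = x - (M *ᵥ ((1 - M)⁻¹ *ᵥ b) + b) := by rw [← hb]
    _ ≤ (M *ᵥ x + b) - (M *ᵥ ((1 - M)⁻¹ *ᵥ b) + b) := sub_le_sub_right hx _
    _ = _ := add_sub_add_right_eq_sub _ _ _

theorem inv_one_sub_nonneg (hM : ∀ i j, 0 ≤ M i j)
    (hρ : spectralRadius ℂ (M.map Complex.ofReal) < 1) (i j : n) : 0 ≤ (1 - M)⁻¹ i j := by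
  have h : (0 : n → ℝ) ≤ (1 - M)⁻¹ *ᵥ Pi.single j 1 :=
    le_inv_one_sub_mulVec hM hρ (by simp)
  simpa using h i

end

end Matrix

/-- if the spectral radius of `|G⁻¹||ΔG|` is less than 1, then
`G + ΔG` is invertible, `I − |G⁻¹||ΔG|` is invertible with entrywise nonnegative
inverse, and `|Δz| ≤ (I − |G⁻¹||ΔG|)⁻¹ |G⁻¹| (|Δf| + |ΔG||z|)` componentwise. -/
theorem componentwise_perturbation_bound
    {N : ℕ} (G ΔG : Matrix (Fin N) (Fin N) ℝ) (f Δf z : Fin N → ℝ)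
    (hG : IsUnit G) (hz : G *ᵥ z = f)
    (hρ : spectralRadius ℂ
        (((G⁻¹.map abs) * (ΔG.map abs)).map (Complex.ofReal)) < 1) :
    IsUnit (G + ΔG) ∧
    IsUnit (1 - (G⁻¹.map abs) * (ΔG.map abs)) ∧
    (∀ i j, (0 : ℝ) ≤ (1 - (G⁻¹.map abs) * (ΔG.map abs))⁻¹ i j) ∧
    ∀ Δz : Fin N → ℝ, (G + ΔG) *ᵥ (z + Δz) = f + Δf →
      ∀ i, |Δz i| ≤
        (((1 - (G⁻¹.map abs) * (ΔG.map abs))⁻¹ * (G⁻¹.map abs)) *ᵥ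
          ((fun j => |Δf j|) + (ΔG.map abs) *ᵥ (fun j => |z j|))) i := by
  have hdet := (isUnit_iff_isUnit_det _).mp hG
  set M := G⁻¹.map abs * ΔG.map abs with hMdef
  have hM : ∀ i j, 0 ≤ M i j := fun i j => by
    rw [hMdef, mul_apply]
    exact Finset.sum_nonneg fun _ _ => mul_nonneg (abs_nonneg _) (abs_nonneg _)
  have hinv : ∀ i j, 0 ≤ G⁻¹.map abs i j := fun i j => abs_nonneg _
  have hbound : ∀ x b : Fin N → ℝ, (G + ΔG) *ᵥ x = b → |x| ≤ M *ᵥ |x| + G⁻¹.map abs *ᵥ |b| := by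
    intro x b hx
    have hxG : x = G⁻¹ *ᵥ (b - ΔG *ᵥ x) := by
      rw [← hx, add_mulVec, add_sub_cancel_right, mulVec_mulVec, nonsing_inv_mul _ hdet,
        one_mulVec]
    calc |x| = |G⁻¹ *ᵥ (b - ΔG *ᵥ x)| := congrArg _ hxG
      _ ≤ G⁻¹.map abs *ᵥ |b - ΔG *ᵥ x| := abs_mulVec_le _ _
      _ ≤ G⁻¹.map abs *ᵥ (ΔG.map abs *ᵥ |x| + |b|) := by
        refine mulVec_le_mulVec_of_nonneg hinv fun i => ?_
        have h := abs_mulVec_le ΔG x i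
        have h' := abs_sub (b i) ((ΔG *ᵥ x) i)
        simp only [Pi.abs_apply, Pi.add_apply, Pi.sub_apply] at h h' ⊢
        linarith
      _ = M *ᵥ |x| + G⁻¹.map abs *ᵥ |b| := by rw [mulVec_add, mulVec_mulVec]
  refine ⟨isUnit_of_mulVec_eq_zero fun x hx => ?_, isUnit_one_sub_of_spectralRadius_lt_one hM hρ,
    inv_one_sub_nonneg hM hρ, fun Δz h => ?_⟩
  · have hx0 : |x| ≤ 0 := nonpos_of_le_mulVec hM hρ (by simpa using hbound x 0 hx)
    exact funext fun i => abs_nonpos_iff.mp (hx0 i)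
  · have hΔz : (G + ΔG) *ᵥ Δz = Δf - ΔG *ᵥ z := by
      rw [mulVec_add, add_mulVec G ΔG z, hz, add_assoc] at h
      exact eq_sub_of_add_eq' (add_left_cancel h)
    rw [← mulVec_mulVec]
    refine le_inv_one_sub_mulVec hM hρ ((hbound _ _ hΔz).trans ?_)
    refine add_le_add_right (mulVec_le_mulVec_of_nonneg hinv fun i => ?_) _
    exact (abs_sub _ _).trans (add_le_add_right (abs_mulVec_le ΔG z i) _)
end

section
/- Let A ∈ ℝ^{m×n} with m ≥ n have full column rank, let W ∈ ℝ^{m×m} be symmetric positive definite, and let b ∈ ℝ^m. Define A† := (AᵀWA)⁻¹AᵀW, x := A†b, and d := W(b − Ax). Then there exist constants C > 0 and ε₀ > 0 such that for every ε with 0 < ε ≤ ε₀ and every ΔA ∈ ℝ^{m×n}, Δb ∈ ℝ^m with |ΔA| ≤ ε|A| and |Δb| ≤ ε|b| (entrywise), the matrix A + ΔA has full column rank and the perturbed weighted least squares solution x̃ := ((A+ΔA)ᵀW(A+ΔA))⁻¹(A+ΔA)ᵀW(b+Δb) satisfies ‖x̃ − x‖_∞ ≤ ε(‖ |A†|(|b|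 + |A||x|) ‖_∞ + ‖ |(AᵀWA)⁻¹| |A|ᵀ |d| ‖_∞) + Cε². -/
open Matrix

theorem abs_mulVec_le_mulVec {k l : Type*} [Fintype l] {M N : Matrix k l ℝ} {v w : l → ℝ}
    (hM : ∀ i j, |M i j| ≤ N i j) (hv : ∀ j, |v j| ≤ w j) (i : k) :
    |(M *ᵥ v) i| ≤ (N *ᵥ w) i := by
  refine (Finset.abs_sum_le_sum_abs _ _).trans (Finset.sum_le_sum fun j _ => ?_)
  rw [abs_mul]
  exact mul_le_mul (hM i j) (hv j) (abs_nonneg _) ((abs_nonneg _).trans (hM i j))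

section InfNorm

variable {k l : Type*} [Fintype k] [Fintype l]

theorem infNormV_eq_norm (v : k → ℝ) : infNormV v = ‖v‖ := by
  refine le_antisymm (Real.iSup_le (fun i => norm_le_pi_norm v i) (norm_nonneg v)) ?_
  refine (pi_norm_le_iff_of_nonneg (Real.iSup_nonneg fun i => abs_nonneg (v i))).2 fun i => ?_
  exact le_ciSup (f := fun i => |v i|) (Set.finite_range _).bddAbove i

theorem norm_le_mul_norm_of_abs_le {v w : k → ℝ} {ε : ℝ} (hε : 0 ≤ ε)
    (h : ∀ i, |v i| ≤ ε * |w i|) : ‖v‖ ≤ ε * ‖w‖ :=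
  (pi_norm_le_iff_of_nonneg (by positivity)).2 fun i =>
    (h i).trans (mul_le_mul_of_nonneg_left (norm_le_pi_norm w i) hε)

open scoped Matrix.Norms.Operator

theorem opNorm_le_mul_opNorm_of_abs_le {M N : Matrix k l ℝ} {ε : ℝ} (hε : 0 ≤ ε)
    (h : ∀ i j, |M i j| ≤ ε * |N i j|) : ‖M‖ ≤ ε * ‖N‖ := by
  have row (P : Matrix k l ℝ) (i : k) : ∑ j, |P i j| ≤ ‖P‖ := by
    rw [linfty_opNorm_def]
    refine le_trans (le_of_eq ?_)
      (NNReal.coe_le_coe.2 (Finset.le_sup (f := fun i => ∑ j, ‖P i j‖₊) (Finset.mem_univ i)))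
    simp
  rw [linfty_opNorm_def M]
  have hr : 0 ≤ ε * ‖N‖ := by positivity
  lift ε * ‖N‖ to NNReal using hr with r hrr
  refine NNReal.coe_le_coe.2 (Finset.sup_le fun i _ => NNReal.coe_le_coe.1 ?_)
  rw [hrr]
  push_cast
  calc ∑ j, ‖M i j‖ ≤ ∑ j, ε * |N i j| := Finset.sum_le_sum fun j _ => h i j
    _ = ε * ∑ j, |N i j| := by rw [Finset.mul_sum]
    _ ≤ ε * ‖N‖ := mul_le_mul_of_nonneg_left (row N i) hε

theorem opNorm_mul_mul_le {p q : Type*} [Fintype p] [Fintype q]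
    (L : Matrix p k ℝ) (M : Matrix k l ℝ) (N : Matrix l q ℝ) :
    ‖L * M * N‖ ≤ ‖L‖ * ‖M‖ * ‖N‖ :=
  (linfty_opNorm_mul _ _).trans
    (mul_le_mul_of_nonneg_right (linfty_opNorm_mul _ _) (norm_nonneg _))

/-- If `C` is a left inverse of `G`, then `v` is controlled by `C H v` and by `H - G`. -/
theorem norm_le_norm_mulVec_add [DecidableEq k] {C G H : Matrix k k ℝ} (hC : C * G = 1)
    (v : k → ℝ) : ‖v‖ ≤ ‖C *ᵥ (H *ᵥ v)‖ + ‖C‖ * ‖H - G‖ * ‖v‖ := by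
  have hv : v = C *ᵥ (H *ᵥ v) - (C * (H - G)) *ᵥ v := by
    rw [Matrix.mul_sub, hC, sub_mulVec, ← mulVec_mulVec, one_mulVec, sub_sub_cancel]
  calc ‖v‖ = ‖C *ᵥ (H *ᵥ v) - (C * (H - G)) *ᵥ v‖ := congrArg _ hv
    _ ≤ ‖C *ᵥ (H *ᵥ v)‖ + ‖(C * (H - G)) *ᵥ v‖ := norm_sub_le _ _
    _ ≤ _ := by
      gcongr
      exact (linfty_opNorm_mulVec _ _).trans
        (mul_le_mul_of_nonneg_right (linfty_opNorm_mul _ _) (norm_nonneg _))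

theorem opNorm_weighted_gram_add_sub_le {A E : Matrix k l ℝ} (W : Matrix k k ℝ) {ε : ℝ}
    (hε : 0 ≤ ε) (hε₁ : ε ≤ 1) (hE : ∀ i j, |E i j| ≤ ε * |A i j|) :
    ‖(A + E)ᵀ * W * (A + E) - Aᵀ * W * A‖ ≤ ε * (3 * (‖Aᵀ‖ * ‖W‖ * ‖A‖)) := by
  have h₁ : ‖E‖ ≤ ε * ‖A‖ := opNorm_le_mul_opNorm_of_abs_le hε hE
  have h₂ : ‖Eᵀ‖ ≤ ε * ‖Aᵀ‖ := opNorm_le_mul_opNorm_of_abs_le hε fun i j => hE j i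
  have hsplit : (A + E)ᵀ * W * (A + E) - Aᵀ * W * A =
      Eᵀ * W * A + Aᵀ * W * E + Eᵀ * W * E := by
    simp only [transpose_add, Matrix.add_mul, Matrix.mul_add]
    abel
  have h₃ : ‖E‖ ≤ ‖A‖ := h₁.trans (mul_le_of_le_one_left (norm_nonneg _) hε₁)
  calc _ = ‖Eᵀ * W * A + Aᵀ * W * E + Eᵀ * W * E‖ := by rw [hsplit]
    _ ≤ ‖Eᵀ‖ * ‖W‖ * ‖A‖ + ‖Aᵀ‖ * ‖W‖ * ‖E‖ + ‖Eᵀ‖ * ‖W‖ * ‖E‖ :=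
      norm_add₃_le.trans (add_le_add_three (opNorm_mul_mul_le _ _ _)
        (opNorm_mul_mul_le _ _ _) (opNorm_mul_mul_le _ _ _))
    _ ≤ (ε * ‖Aᵀ‖) * ‖W‖ * ‖A‖ + ‖Aᵀ‖ * ‖W‖ * (ε * ‖A‖) + (ε * ‖Aᵀ‖) * ‖W‖ * ‖A‖ := by
      gcongr
    _ = _ := by ring

end InfNorm

theorem Matrix.mulVec_injective_iff_rank_eq {m n : ℕ} (A : Matrix (Fin m) (Fin n) ℝ) :
    Function.Injective A.mulVec ↔ A.rank = n := by
  have h := A.mulVecLin.finrank_range_add_finrank_ker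
  rw [Module.finrank_fin_fun] at h
  rw [← coe_mulVecLin, ← LinearMap.ker_eq_bot, ← Submodule.finrank_eq_zero, Matrix.rank]
  omega

open scoped Matrix.Norms.Operator in
/-- first-order componentwise perturbation bound for the weighted
least squares solution:
`‖x̃ − x‖_∞ ≤ ε(‖|A†|(|b| + |A||x|)‖_∞ + ‖|(AᵀWA)⁻¹||A|ᵀ|d|‖_∞) + Cε²`. -/
theorem wls_solution_perturbation_bound
    {m n : ℕ} (hmn : n ≤ m)
    (A : Matrix (Fin m) (Fin n) ℝ) (hA : A.rank = n)
    (W : Matrix (Fin m) (Fin m) ℝ) (hWsym : W.IsSymm) (hW : W.PosDef)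
    (b : Fin m → ℝ) :
    let C := (Aᵀ * W * A)⁻¹
    let Adag := C * Aᵀ * W
    let x := Adag *ᵥ b
    let d := W *ᵥ (b - A *ᵥ x)
    ∃ c₀ > (0 : ℝ), ∃ ε₀ > (0 : ℝ), ∀ ε : ℝ, 0 < ε → ε ≤ ε₀ →
      ∀ (ΔA : Matrix (Fin m) (Fin n) ℝ) (Δb : Fin m → ℝ),
        (∀ i j, |ΔA i j| ≤ ε * |A i j|) → (∀ i, |Δb i| ≤ ε * |b i|) →
        (A + ΔA).rank = n ∧
        infNormV ((((A + ΔA)ᵀ * W * (A + ΔA))⁻¹ * (A + ΔA)ᵀ * W) *ᵥ (b + Δb) - x) ≤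
          ε * (infNormV ((Adag.map abs) *ᵥ
                  ((fun i => |b i|) + (A.map abs) *ᵥ (fun j => |x j|))) +
               infNormV ((C.map abs) *ᵥ ((Aᵀ.map abs) *ᵥ (fun i => |d i|)))) +
            c₀ * ε ^ 2 := by
  intro C Adag x d
  have hG : IsUnit (Aᵀ * W * A).det := by
    have := (hW.conjTranspose_mul_mul_same (A.mulVec_injective_iff_rank_eq.2 hA)).det_pos
    rw [conjTranspose_eq_transpose_of_trivial] at this
    exact this.ne'.isUnit
  have hCG : C * (Aᵀ * W * A) = 1 := nonsing_inv_mul _ hG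
  have hGx : (Aᵀ * W * A) *ᵥ x = (Aᵀ * W) *ᵥ b := by
    rw [mulVec_mulVec, show Adag = C * (Aᵀ * W) from Matrix.mul_assoc _ _ _, mul_nonsing_inv_cancel_left _ _ hG]
  simp only [infNormV_eq_norm]
  set s₁ := (Adag.map abs) *ᵥ ((fun i => |b i|) + (A.map abs) *ᵥ (fun j => |x j|)) with hs₁
  set s₂ := (C.map abs) *ᵥ ((Aᵀ.map abs) *ᵥ (fun i => |d i|)) with hs₂
  set S := ‖s₁‖ + ‖s₂‖ with hS
  set K₁ := ‖C‖ * (‖Aᵀ‖ * ‖W‖ * (‖b‖ + ‖A‖ * ‖x‖)) with hK₁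
  set K₂ := ‖C‖ * (3 * (‖Aᵀ‖ * ‖W‖ * ‖A‖)) with hK₂
  have hS0 : 0 ≤ S := by positivity
  have hK₁0 : 0 ≤ K₁ := by positivity
  have hK₂0 : 0 ≤ K₂ := by positivity
  refine ⟨K₁ + 2 * K₂ * (S + K₁) + 1, by positivity, 1 / (2 * K₂ + 1), by positivity, ?_⟩
  intro ε hε hεle E f hE hf
  rw [le_div_iff₀ (by positivity)] at hεle
  have hε₁ : ε ≤ 1 := by nlinarith
  have hεK : ε * K₂ ≤ 1 / 2 := by nlinarith
  set H := (A + E)ᵀ * W * (A + E) with hH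
  have hcontr (v : Fin n → ℝ) : ‖v‖ ≤ ‖C *ᵥ (H *ᵥ v)‖ + ε * K₂ * ‖v‖ := by
    refine (norm_le_norm_mulVec_add (H := H) hCG v).trans ?_
    have := opNorm_weighted_gram_add_sub_le W hε.le hε₁ hE
    calc _ ≤ ‖C *ᵥ (H *ᵥ v)‖ + ‖C‖ * (ε * (3 * (‖Aᵀ‖ * ‖W‖ * ‖A‖))) * ‖v‖ := by gcongr
      _ = _ := by rw [hK₂]; ring
  have hker (v : Fin n → ℝ) (hv : H *ᵥ v = 0) : v = 0 := by
    have := hcontr v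
    rw [hv, mulVec_zero, norm_zero] at this
    exact norm_le_zero_iff.1 (by nlinarith [norm_nonneg v])
  have hHinj : Function.Injective H.mulVec := by
    intro u v huv
    exact sub_eq_zero.1 (hker _ (by rw [mulVec_sub, sub_eq_zero]; exact huv))
  have hHunit : IsUnit H.det :=
    (isUnit_iff_isUnit_det H).1 (mulVec_injective_iff_isUnit.1 hHinj)
  refine ⟨(mulVec_injective_iff_rank_eq _).1 fun u v huv => hHinj ?_, ?_⟩
  · simp only [hH, ← mulVec_mulVec, huv]
  set δ := (H⁻¹ * (A + E)ᵀ * W) *ᵥ (b + f) - x with hδ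
  set r := f - E *ᵥ x with hr
  have hHδ : C *ᵥ (H *ᵥ δ) = C *ᵥ (Eᵀ *ᵥ d) + Adag *ᵥ r + C *ᵥ ((Eᵀ * W) *ᵥ r) := by
    have hHx : H *ᵥ δ = ((A + E)ᵀ * W) *ᵥ (b + f) - H *ᵥ x := by
      rw [hδ, mulVec_sub, mulVec_mulVec, Matrix.mul_assoc H⁻¹,
        mul_nonsing_inv_cancel_left _ _ hHunit]
    have hAd : Aᵀ *ᵥ d = 0 := by
      rw [mulVec_mulVec, mulVec_sub, mulVec_mulVec, hGx, sub_self]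
    have : H *ᵥ δ = Eᵀ *ᵥ d + (Aᵀ * W) *ᵥ r + (Eᵀ * W) *ᵥ r := by
      have hres : b + f - (A + E) *ᵥ x = (b - A *ᵥ x) + r := by
        rw [add_mulVec, hr]; abel
      calc H *ᵥ δ = (A + E)ᵀ *ᵥ (W *ᵥ (b + f - (A + E) *ᵥ x)) := by
            rw [hHx, hH, mulVec_mulVec _ (A + E)ᵀ, mulVec_sub, mulVec_mulVec x]
        _ = Aᵀ *ᵥ d + Eᵀ *ᵥ d + (Aᵀ * W) *ᵥ r + (Eᵀ * W) *ᵥ r := by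
            rw [hres, mulVec_add, transpose_add, mulVec_add, add_mulVec, add_mulVec,
              mulVec_mulVec r, mulVec_mulVec r]
            abel
        _ = _ := by rw [hAd, zero_add]
    rw [this, mulVec_add, mulVec_add, mulVec_mulVec r C (Aᵀ * W), ← Matrix.mul_assoc]
  have h₁ : ‖Adag *ᵥ r‖ ≤ ε * ‖s₁‖ := by
    refine norm_le_mul_norm_of_abs_le hε.le fun i => ?_
    have hrj (j : Fin m) : |r j| ≤ (ε • ((fun i => |b i|) + A.map abs *ᵥ fun j => |x j|)) j := by
      have := abs_mulVec_le_mulVec (N := ε • A.map abs) (w := fun j => |x j|) hE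
        (fun j => le_rfl) j
      rw [smul_mulVec] at this
      simp only [hr, Pi.sub_apply, Pi.smul_apply, Pi.add_apply, smul_eq_mul, mul_add] at this ⊢
      exact (abs_sub _ _).trans (add_le_add (hf j) this)
    have := abs_mulVec_le_mulVec (N := Adag.map abs) (fun _ _ => le_rfl) hrj i
    rw [mulVec_smul] at this
    exact this.trans (mul_le_mul_of_nonneg_left (le_abs_self _) hε.le)
  have h₂ : ‖C *ᵥ (Eᵀ *ᵥ d)‖ ≤ ε * ‖s₂‖ := by
    refine norm_le_mul_norm_of_abs_le hε.le fun i => ?_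
    have hj (j : Fin n) := abs_mulVec_le_mulVec (M := Eᵀ) (N := ε • Aᵀ.map abs)
      (w := fun j => |d j|) (fun i j => hE j i) (fun j => le_rfl) j
    have := abs_mulVec_le_mulVec (N := C.map abs) (fun _ _ => le_rfl) hj i
    rw [smul_mulVec, mulVec_smul] at this
    exact this.trans (mul_le_mul_of_nonneg_left (le_abs_self _) hε.le)
  have h₃ : ‖C *ᵥ ((Eᵀ * W) *ᵥ r)‖ ≤ ε ^ 2 * K₁ := by
    have hET : ‖Eᵀ‖ ≤ ε * ‖Aᵀ‖ := opNorm_le_mul_opNorm_of_abs_le hε.le fun i j => hE j i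
    have hEn : ‖E‖ ≤ ε * ‖A‖ := opNorm_le_mul_opNorm_of_abs_le hε.le hE
    have hrn : ‖r‖ ≤ ε * (‖b‖ + ‖A‖ * ‖x‖) :=
      calc ‖r‖ ≤ ‖f‖ + ‖E *ᵥ x‖ := norm_sub_le _ _
        _ ≤ ε * ‖b‖ + ε * ‖A‖ * ‖x‖ := by
          gcongr
          · exact norm_le_mul_norm_of_abs_le hε.le hf
          · exact (linfty_opNorm_mulVec _ _).trans (by gcongr)
        _ = _ := by ring
    calc _ ≤ ‖C‖ * (‖Eᵀ‖ * ‖W‖ * ‖r‖) := by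
          refine (linfty_opNorm_mulVec _ _).trans ?_
          gcongr
          refine (linfty_opNorm_mulVec _ _).trans ?_
          gcongr
          exact linfty_opNorm_mul _ _
      _ ≤ ‖C‖ * ((ε * ‖Aᵀ‖) * ‖W‖ * (ε * (‖b‖ + ‖A‖ * ‖x‖))) := by gcongr
      _ = _ := by rw [hK₁]; ring
  have h₄ : ‖δ‖ ≤ ε * S + ε ^ 2 * K₁ + ε * K₂ * ‖δ‖ := by
    refine (hcontr δ).trans (add_le_add_left ?_ _)
    rw [hHδ, hS, mul_add]
    exact norm_add₃_le.trans (by linarith)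
  have h₅ : ‖δ‖ ≤ 2 * ε * (S + K₁) := by
    have : ε ^ 2 * K₁ ≤ ε * K₁ := by gcongr; nlinarith
    have : ε * K₂ * ‖δ‖ ≤ 1 / 2 * ‖δ‖ := by gcongr
    linarith
  have h₆ : ε * K₂ * ‖δ‖ ≤ ε * K₂ * (2 * ε * (S + K₁)) := by gcongr
  nlinarith [sq_nonneg ε]
end

section
/- Let A ∈ ℝ^{m×n} with m ≥ n have full column rank, let W ∈ ℝ^{m×m} be symmetric positive definite, and let b ∈ ℝ^m. Define A† := (AᵀWA)⁻¹AᵀW, x := A†b, and d := W(b − Ax). Then there exist constants C > 0 and ε₀ > 0 such that for every ε with 0 < ε ≤ ε₀ and every ΔA ∈ ℝ^{m×n}, Δb ∈ ℝ^m with |ΔA| ≤ ε|A| and |Δb| ≤ ε|b| (entrywise), the matrix A + ΔA has full column rank and the perturbed weighted residual d̃ := W(b + Δb − (A+ΔA)x̃), where x̃ := ((A+ΔA)ᵀW(A+ΔA))⁻¹(A+ΔA)ᵀW(b+Δb), satisfies ‖d̃ − d‖_∞ ≤ ε(‖ |W − WA(AᵀWA)⁻¹AᵀW| (|b| + |A||x|)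 ‖_∞ + ‖ |WA(AᵀWA)⁻¹| |A|ᵀ |d| ‖_∞) + Cε². -/
open Matrix

open scoped Matrix.Norms.Operator

lemma infNormV_eq_norm_s19 {p : Type*} [Fintype p] (v : p → ℝ) : infNormV v = ‖v‖ := by
  apply le_antisymm
  · exact Real.iSup_le (fun i => norm_le_pi_norm v i) (norm_nonneg v)
  · refine (pi_norm_le_iff_of_nonneg (Real.iSup_nonneg fun i => abs_nonneg (v i))).2 fun i => ?_
    exact le_ciSup (f := fun i => |v i|) (Set.finite_range _).bddAbove i

section Entrywise

variable {p q : Type*} [Fintype q]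

lemma abs_mulVec_apply_le {M N : Matrix p q ℝ} {v w : q → ℝ}
    (hM : ∀ i j, |M i j| ≤ N i j) (hv : ∀ j, |v j| ≤ w j) (i : p) :
    |(M *ᵥ v) i| ≤ (N *ᵥ w) i := by
  refine (Finset.abs_sum_le_sum_abs _ _).trans (Finset.sum_le_sum fun j _ => ?_)
  rw [abs_mul]
  exact mul_le_mul (hM i j) (hv j) (abs_nonneg _) ((abs_nonneg _).trans (hM i j))

variable [Fintype p]

lemma norm_mulVec_le_norm_map_abs_mulVec (M : Matrix p q ℝ) {v w : q → ℝ}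
    (hv : ∀ j, |v j| ≤ w j) : ‖M *ᵥ v‖ ≤ ‖M.map abs *ᵥ w‖ := by
  refine (pi_norm_le_iff_of_nonneg (norm_nonneg _)).2 fun i => ?_
  exact (abs_mulVec_apply_le (N := M.map abs) (fun _ _ => le_rfl) hv i).trans
    ((le_abs_self _).trans (norm_le_pi_norm (M.map abs *ᵥ w) i))

lemma norm_mulVec_le_mul_norm_of_abs_le {A E : Matrix p q ℝ} {ε : ℝ} (hε : 0 ≤ ε)
    (hE : ∀ i j, |E i j| ≤ ε * |A i j|) (v : q → ℝ) : ‖E *ᵥ v‖ ≤ ε * (‖A‖ * ‖v‖) := by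
  have h : ‖E *ᵥ v‖ ≤ ‖(ε • A.map abs) *ᵥ fun j => |v j|‖ := by
    refine (pi_norm_le_iff_of_nonneg (norm_nonneg _)).2 fun i => ?_
    exact (abs_mulVec_apply_le (N := ε • A.map abs) (fun i j => hE i j) (fun _ => le_rfl) i).trans
      ((le_abs_self _).trans (norm_le_pi_norm ((ε • A.map abs) *ᵥ fun j => |v j|) i))
  have habs : ‖A.map abs‖ = ‖A‖ := by
    simp [Matrix.linfty_opNorm_def]
  have hv : ‖fun j => |v j|‖ = ‖v‖ := by
    simp [Pi.norm_def]
  rw [smul_mulVec, norm_smul, Real.norm_of_nonneg hε] at h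
  refine h.trans (mul_le_mul_of_nonneg_left ?_ hε)
  simpa only [habs, hv] using Matrix.linfty_opNorm_mulVec (A.map abs) (fun j => |v j|)

end Entrywise

section FullRank

variable {p q : Type*} [Fintype q]

lemma rank_eq_card_iff_mulVec_injective (A : Matrix p q ℝ) :
    A.rank = Fintype.card q ↔ Function.Injective A.mulVec := by
  rw [Matrix.mulVec_injective_iff, linearIndependent_iff_card_eq_finrank_span,
    Matrix.rank_eq_finrank_span_cols]
  exact eq_comm

variable [Fintype p]

lemma isUnit_det_gram [DecidableEq q] {A : Matrix p q ℝ} {W : Matrix p p ℝ}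
    (hW : W.PosDef) (hA : Function.Injective A.mulVec) : IsUnit (Aᵀ * W * A).det := by
  have h := hW.conjTranspose_mul_mul_same hA
  rw [conjTranspose_eq_transpose_of_trivial] at h
  exact h.det_pos.ne'.isUnit

variable [DecidableEq q]

lemma transpose_mulVec_residual {A : Matrix p q ℝ} {W : Matrix p p ℝ}
    (hG : IsUnit (Aᵀ * W * A).det) (b : p → ℝ) :
    Aᵀ *ᵥ (W *ᵥ (b - A *ᵥ (((Aᵀ * W * A)⁻¹ * Aᵀ * W) *ᵥ b))) = 0 := by
  have h : Aᵀ * W * A * ((Aᵀ * W * A)⁻¹ * Aᵀ * W) = Aᵀ * W := by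
    rw [Matrix.mul_assoc _ Aᵀ W, Matrix.mul_nonsing_inv_cancel_left _ _ hG]
  rw [mulVec_mulVec, mulVec_sub, mulVec_mulVec, mulVec_mulVec, h, sub_self]

/-- The augmented system satisfied by the perturbations of the solution and of the weighted
residual, solved for these perturbations. -/
lemma solution_and_residual_sub_eq {A E : Matrix p q ℝ} {W : Matrix p p ℝ}
    (hG : IsUnit (Aᵀ * W * A).det) {b f : p → ℝ} {x y : q → ℝ} {d e : p → ℝ}
    (hd : d = W *ᵥ (b - A *ᵥ x)) (he : e = W *ᵥ (b + f - (A + E) *ᵥ y))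
    (hAd : Aᵀ *ᵥ d = 0) (hAe : (A + E)ᵀ *ᵥ e = 0) :
    y - x = ((Aᵀ * W * A)⁻¹ * Aᵀ * W) *ᵥ (f - E *ᵥ y) + (Aᵀ * W * A)⁻¹ *ᵥ (Eᵀ *ᵥ e) ∧
    e - d = (W - W * A * (Aᵀ * W * A)⁻¹ * Aᵀ * W) *ᵥ (f - E *ᵥ y)
      - (W * A * (Aᵀ * W * A)⁻¹) *ᵥ (Eᵀ *ᵥ e) := by
  have hed : e - d = W *ᵥ (f - E *ᵥ y) - (W * A) *ᵥ (y - x) := by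
    rw [he, hd, ← mulVec_mulVec, ← mulVec_sub, ← mulVec_sub]
    congr 1
    rw [add_mulVec, mulVec_sub]
    abel
  have hAed : Aᵀ *ᵥ (e - d) = -(Eᵀ *ᵥ e) := by
    rw [transpose_add, add_mulVec] at hAe
    rw [mulVec_sub, hAd, sub_zero]
    exact eq_neg_of_add_eq_zero_left hAe
  have hnormal : (Aᵀ * W * A) *ᵥ (y - x) = (Aᵀ * W) *ᵥ (f - E *ᵥ y) + Eᵀ *ᵥ e := by
    rw [hed, mulVec_sub, mulVec_mulVec, mulVec_mulVec, ← Matrix.mul_assoc] at hAed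
    rw [← neg_eq_iff_eq_neg] at hAed
    rw [← hAed]
    abel
  have hyx : y - x = ((Aᵀ * W * A)⁻¹ * Aᵀ * W) *ᵥ (f - E *ᵥ y)
      + (Aᵀ * W * A)⁻¹ *ᵥ (Eᵀ *ᵥ e) := by
    calc y - x = (Aᵀ * W * A)⁻¹ *ᵥ ((Aᵀ * W * A) *ᵥ (y - x)) := by
          rw [mulVec_mulVec, Matrix.nonsing_inv_mul _ hG, one_mulVec]
      _ = _ := by rw [hnormal, mulVec_add, mulVec_mulVec, Matrix.mul_assoc _ Aᵀ W]
  refine ⟨hyx, ?_⟩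
  rw [hed, hyx, mulVec_add, mulVec_mulVec, mulVec_mulVec, sub_mulVec]
  simp only [Matrix.mul_assoc]
  abel

lemma mulVec_injective_add {A E : Matrix p q ℝ} {W : Matrix p p ℝ}
    (hG : IsUnit (Aᵀ * W * A).det) {ε : ℝ} (hε : 0 ≤ ε)
    (hE : ∀ i j, |E i j| ≤ ε * |A i j|)
    (hsmall : ε * (‖(Aᵀ * W * A)⁻¹ * Aᵀ * W‖ * ‖A‖) < 1) :
    Function.Injective (A + E).mulVec := by
  have hker : ∀ v, (A + E) *ᵥ v = 0 → v = 0 := by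
    intro v hv
    have h : v = -(((Aᵀ * W * A)⁻¹ * Aᵀ * W) *ᵥ (E *ᵥ v)) := by
      rw [add_mulVec, add_eq_zero_iff_neg_eq] at hv
      rw [← hv, mulVec_neg, neg_neg, mulVec_mulVec, Matrix.mul_assoc, Matrix.mul_assoc,
        ← Matrix.mul_assoc Aᵀ, Matrix.nonsing_inv_mul _ hG, one_mulVec]
    have hle : ‖v‖ ≤ ε * (‖(Aᵀ * W * A)⁻¹ * Aᵀ * W‖ * ‖A‖) * ‖v‖ := by
      calc ‖v‖ = ‖((Aᵀ * W * A)⁻¹ * Aᵀ * W) *ᵥ (E *ᵥ v)‖ := by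
            conv_lhs => rw [h, norm_neg]
        _ ≤ ‖(Aᵀ * W * A)⁻¹ * Aᵀ * W‖ * ‖E *ᵥ v‖ := Matrix.linfty_opNorm_mulVec _ _
        _ ≤ ‖(Aᵀ * W * A)⁻¹ * Aᵀ * W‖ * (ε * (‖A‖ * ‖v‖)) := by
            gcongr
            exact norm_mulVec_le_mul_norm_of_abs_le hε hE v
        _ = _ := by ring
    by_contra hne
    nlinarith [norm_pos_iff.2 hne]
  intro u v huv
  refine sub_eq_zero.1 (hker _ ?_)
  rw [mulVec_sub]
  exact sub_eq_zero.2 huv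

end FullRank

/-- first-order componentwise perturbation bound for the weighted
residual:
`‖d̃ − d‖_∞ ≤ ε(‖|W − WA(AᵀWA)⁻¹AᵀW|(|b| + |A||x|)‖_∞ +
‖|WA(AᵀWA)⁻¹||A|ᵀ|d|‖_∞) + Cε²`. -/
theorem wls_residual_perturbation_bound
    {m n : ℕ} (hmn : n ≤ m)
    (A : Matrix (Fin m) (Fin n) ℝ) (hA : A.rank = n)
    (W : Matrix (Fin m) (Fin m) ℝ) (hWsym : W.IsSymm) (hW : W.PosDef)
    (b : Fin m → ℝ) :
    let C := (Aᵀ * W * A)⁻¹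
    let Adag := C * Aᵀ * W
    let x := Adag *ᵥ b
    let d := W *ᵥ (b - A *ᵥ x)
    ∃ c₀ > (0 : ℝ), ∃ ε₀ > (0 : ℝ), ∀ ε : ℝ, 0 < ε → ε ≤ ε₀ →
      ∀ (ΔA : Matrix (Fin m) (Fin n) ℝ) (Δb : Fin m → ℝ),
        (∀ i j, |ΔA i j| ≤ ε * |A i j|) → (∀ i, |Δb i| ≤ ε * |b i|) →
        (A + ΔA).rank = n ∧
        infNormV (W *ᵥ (b + Δb - (A + ΔA) *ᵥ
              ((((A + ΔA)ᵀ * W * (A + ΔA))⁻¹ * (A + ΔA)ᵀ * W) *ᵥ (b + Δb))) - d) ≤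
          ε * (infNormV (((W - W * A * C * Aᵀ * W).map abs) *ᵥ
                  ((fun i => |b i|) + (A.map abs) *ᵥ (fun j => |x j|))) +
               infNormV (((W * A * C).map abs) *ᵥ
                  ((Aᵀ.map abs) *ᵥ (fun i => |d i|)))) +
            c₀ * ε ^ 2 := by
  intro C Adag x d
  have hG : IsUnit (Aᵀ * W * A).det :=
    isUnit_det_gram hW ((rank_eq_card_iff_mulVec_injective A).1 (by simpa using hA))
  set M := W - W * A * C * Aᵀ * W
  set N := W * A * C
  set β := ‖b‖ + ‖A‖ * ‖x‖ with hβ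
  have hβ0 : 0 ≤ β := by positivity
  set K := (‖Adag‖ + ‖M‖) * (β + ‖A‖) + (‖C‖ + ‖N‖) * (‖Aᵀ‖ * (‖d‖ + 1)) + 1 with hK
  have hK0 : 0 < K := by positivity
  refine ⟨(‖M‖ * ‖A‖ + ‖N‖ * ‖Aᵀ‖) * (2 * K) + 1, by positivity, 1 / (2 * K), by positivity, ?_⟩
  intro ε hε hεK E f hE hf
  have hKε : ε * K ≤ 1 / 2 := by
    rw [le_div_iff₀ (by positivity)] at hεK
    linarith
  have hET : ∀ i j, |Eᵀ i j| ≤ ε * |Aᵀ i j| := fun i j => hE j i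
  have hinj : Function.Injective (A + E).mulVec := by
    refine mulVec_injective_add hG hε.le hE ?_
    have hle : ‖Adag‖ * ‖A‖ ≤ K := by
      have h : 0 ≤ ‖Adag‖ * β + ‖M‖ * (β + ‖A‖) + (‖C‖ + ‖N‖) * (‖Aᵀ‖ * (‖d‖ + 1)) + 1 := by
        positivity
      rw [hK]
      linarith
    calc ε * (‖Adag‖ * ‖A‖) ≤ ε * K := by gcongr
      _ < 1 := by linarith
  refine ⟨by simpa using (rank_eq_card_iff_mulVec_injective (A + E)).2 hinj, ?_⟩
  have hAe := transpose_mulVec_residual (isUnit_det_gram hW hinj) (b + f)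
  set y := (((A + E)ᵀ * W * (A + E))⁻¹ * (A + E)ᵀ * W) *ᵥ (b + f)
  set e := W *ᵥ (b + f - (A + E) *ᵥ y) with he
  obtain ⟨hyx, hed⟩ := solution_and_residual_sub_eq hG (d := d) (x := x) rfl he
    (transpose_mulVec_residual hG b) hAe
  change y - x = Adag *ᵥ (f - E *ᵥ y) + C *ᵥ (Eᵀ *ᵥ e) at hyx
  change e - d = M *ᵥ (f - E *ᵥ y) - N *ᵥ (Eᵀ *ᵥ e) at hed
  have hfnorm : ‖f‖ ≤ ε * ‖b‖ := by
    refine (pi_norm_le_iff_of_nonneg (by positivity)).2 fun i => (hf i).trans ?_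
    gcongr
    exact norm_le_pi_norm b i
  have hr : ‖f - E *ᵥ y‖ ≤ ε * (β + ‖A‖ * ‖y - x‖) := by
    have hy' : ‖y‖ ≤ ‖x‖ + ‖y - x‖ := norm_le_insert' y x
    calc ‖f - E *ᵥ y‖ ≤ ‖f‖ + ‖E *ᵥ y‖ := norm_sub_le _ _
      _ ≤ ε * ‖b‖ + ε * (‖A‖ * ‖y‖) :=
          add_le_add hfnorm (norm_mulVec_le_mul_norm_of_abs_le hε.le hE y)
      _ ≤ ε * ‖b‖ + ε * (‖A‖ * (‖x‖ + ‖y - x‖)) := by gcongr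
      _ = _ := by rw [hβ]; ring
  have hs : ‖Eᵀ *ᵥ e‖ ≤ ε * (‖Aᵀ‖ * (‖d‖ + ‖e - d‖)) := by
    refine (norm_mulVec_le_mul_norm_of_abs_le hε.le hET e).trans ?_
    gcongr
    exact norm_le_insert' e d
  have hp : ‖y - x‖ ≤ ‖Adag‖ * (ε * (β + ‖A‖ * ‖y - x‖))
      + ‖C‖ * (ε * (‖Aᵀ‖ * (‖d‖ + ‖e - d‖))) := by
    calc ‖y - x‖ ≤ ‖Adag *ᵥ (f - E *ᵥ y)‖ + ‖C *ᵥ (Eᵀ *ᵥ e)‖ := by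
          conv_lhs => rw [hyx]
          exact norm_add_le _ _
      _ ≤ ‖Adag‖ * ‖f - E *ᵥ y‖ + ‖C‖ * ‖Eᵀ *ᵥ e‖ :=
          add_le_add (Matrix.linfty_opNorm_mulVec _ _) (Matrix.linfty_opNorm_mulVec _ _)
      _ ≤ _ := by gcongr
  have hq : ‖e - d‖ ≤ ‖M‖ * (ε * (β + ‖A‖ * ‖y - x‖))
      + ‖N‖ * (ε * (‖Aᵀ‖ * (‖d‖ + ‖e - d‖))) := by
    calc ‖e - d‖ ≤ ‖M *ᵥ (f - E *ᵥ y)‖ + ‖N *ᵥ (Eᵀ *ᵥ e)‖ := by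
          conv_lhs => rw [hed]
          exact norm_sub_le _ _
      _ ≤ ‖M‖ * ‖f - E *ᵥ y‖ + ‖N‖ * ‖Eᵀ *ᵥ e‖ :=
          add_le_add (Matrix.linfty_opNorm_mulVec _ _) (Matrix.linfty_opNorm_mulVec _ _)
      _ ≤ _ := by gcongr
  have hpq : ‖y - x‖ + ‖e - d‖ ≤ 2 * K * ε := by
    set s := ‖y - x‖ + ‖e - d‖ with hsdef
    have hs0 : 0 ≤ s := by positivity
    have h1 : β + ‖A‖ * ‖y - x‖ ≤ (β + ‖A‖) * (1 + s) := by
      have : ‖A‖ * ‖y - x‖ ≤ ‖A‖ * s := by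
        gcongr
        exact le_add_of_nonneg_right (norm_nonneg _)
      nlinarith [mul_nonneg hβ0 hs0, norm_nonneg A]
    have h2 : ‖d‖ + ‖e - d‖ ≤ (‖d‖ + 1) * (1 + s) := by
      have : ‖e - d‖ ≤ s := le_add_of_nonneg_left (norm_nonneg _)
      nlinarith [mul_nonneg (norm_nonneg d) hs0]
    have h3 : s ≤ ε * K * (1 + s) := by
      calc s ≤ ε * ((‖Adag‖ + ‖M‖) * (β + ‖A‖ * ‖y - x‖)
            + (‖C‖ + ‖N‖) * (‖Aᵀ‖ * (‖d‖ + ‖e - d‖))) := by linarith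
        _ ≤ ε * ((‖Adag‖ + ‖M‖) * ((β + ‖A‖) * (1 + s))
            + (‖C‖ + ‖N‖) * (‖Aᵀ‖ * ((‖d‖ + 1) * (1 + s)))) := by gcongr
        _ = ε * (K - 1) * (1 + s) := by rw [hK]; ring
        _ ≤ ε * K * (1 + s) := by gcongr; linarith
    nlinarith [mul_le_mul_of_nonneg_right hKε hs0]
  have hsplit : e - d = M *ᵥ (f - E *ᵥ x) - N *ᵥ (Eᵀ *ᵥ d)
      - (M *ᵥ (E *ᵥ (y - x)) + N *ᵥ (Eᵀ *ᵥ (e - d))) := by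
    rw [mulVec_sub E, mulVec_sub Eᵀ, mulVec_sub N, mulVec_sub M (E *ᵥ y), mulVec_sub M f]
    rw [hed, mulVec_sub M f]
    abel
  have hfirst : ‖M *ᵥ (f - E *ᵥ x)‖ ≤
      ε * ‖M.map abs *ᵥ ((fun i => |b i|) + A.map abs *ᵥ (fun j => |x j|))‖ := by
    rw [← Real.norm_of_nonneg hε.le, ← norm_smul, ← mulVec_smul]
    refine norm_mulVec_le_norm_map_abs_mulVec M fun i => ?_
    have hEx := abs_mulVec_apply_le (N := ε • A.map abs) (v := x) (fun i j => hE i j)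
      (fun _ => le_rfl) i
    rw [smul_mulVec] at hEx
    refine (abs_sub _ _).trans ?_
    simpa only [Pi.smul_apply, Pi.add_apply, smul_eq_mul, mul_add] using add_le_add (hf i) hEx
  have hsecond : ‖N *ᵥ (Eᵀ *ᵥ d)‖ ≤ ε * ‖N.map abs *ᵥ (Aᵀ.map abs *ᵥ (fun i => |d i|))‖ := by
    rw [← Real.norm_of_nonneg hε.le, ← norm_smul, ← mulVec_smul]
    refine norm_mulVec_le_norm_map_abs_mulVec N fun i => ?_
    rw [← smul_mulVec]
    exact abs_mulVec_apply_le (fun i j => hET i j) (fun _ => le_rfl) i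
  have hthird : ‖M *ᵥ (E *ᵥ (y - x))‖ ≤ ‖M‖ * (ε * (‖A‖ * (2 * K * ε))) := by
    refine (Matrix.linfty_opNorm_mulVec _ _).trans ?_
    gcongr
    refine (norm_mulVec_le_mul_norm_of_abs_le hε.le hE _).trans ?_
    gcongr
    linarith [norm_nonneg (e - d)]
  have hfourth : ‖N *ᵥ (Eᵀ *ᵥ (e - d))‖ ≤ ‖N‖ * (ε * (‖Aᵀ‖ * (2 * K * ε))) := by
    refine (Matrix.linfty_opNorm_mulVec _ _).trans ?_
    gcongr
    refine (norm_mulVec_le_mul_norm_of_abs_le hε.le hET _).trans ?_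
    gcongr
    linarith [norm_nonneg (y - x)]
  simp only [infNormV_eq_norm_s19]
  have hnorm : ‖e - d‖ ≤ ‖M *ᵥ (f - E *ᵥ x)‖ + ‖N *ᵥ (Eᵀ *ᵥ d)‖
      + (‖M *ᵥ (E *ᵥ (y - x))‖ + ‖N *ᵥ (Eᵀ *ᵥ (e - d))‖) := by
    conv_lhs => rw [hsplit]
    exact (norm_sub_le _ _).trans (add_le_add (norm_sub_le _ _) (norm_add_le _ _))
  linarith [sq_nonneg ε]
end
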